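/- For every integer n ≥ 1, the sets V ⊆ X'_n that occur as the invertex of some dominant metapath M(V,{x'}) in H_n with target x' ∈ X'_n are exactly the pairs {A_i, B_j} with 0 ≤ j ≤ i ≤ n together with the singletons {A_i} with 1 ≤ i ≤ n; consequently there are (n+1)(n+2)/2 + n = (n²+5n+2)/2 such distinct invertices. -/

import Mathlib

/-- An edge of a metagraph: an invertex set and an outvertex set. -/
structure MEdge (α : Type*) where
  inv : Set α
  out : Set α

namespace MG

variable {α : Type*}

/-- `p` is a simple path from `x` to `y` using edges from `E`:
a nonempty sequence of edges of `E` with `x` in the invertex of the first edge,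
`y` in the outvertex of the last edge, and consecutive edges sharing an element
(outvertex of one meets invertex of the next). -/
def IsSimplePath (E : Set (MEdge α)) (p : List (MEdge α)) (x y : α) : Prop :=
  p ≠ [] ∧ (∀ e ∈ p, e ∈ E) ∧
  (∀ h : p ≠ [], x ∈ (p.head h).inv ∧ y ∈ (p.getLast h).out) ∧
  p.Chain' (fun e f => (e.out ∩ f.inv).Nonempty)

/-- Clauses (2) and (3) of the metapath definition: the pure inputs of `E'`
are contained in the source `B`, and the target `C` is covered by the union of
the outvertices. -/
def IsRelaxedMetapath (E : Set (MEdge α)) (B C : Set α) (E' : Set (MEdge α)) : Prop :=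
  E' ⊆ E ∧
  ((⋃ e ∈ E', e.inv) \ (⋃ e ∈ E', e.out)) ⊆ B ∧
  C ⊆ ⋃ e ∈ E', e.out

/-- Full metapath definition: clauses (2) and (3) together with clause (1),
that every edge of `E'` lies on a simple path (within `E'`) from some element
of `B` to some element of `C`. -/
def IsMetapath (E : Set (MEdge α)) (B C : Set α) (E' : Set (MEdge α)) : Prop :=
  IsRelaxedMetapath E B C E' ∧
  ∀ e ∈ E', ∃ (p : List (MEdge α)) (x y : α),
    x ∈ B ∧ y ∈ C ∧ e ∈ p ∧ IsSimplePath E' p x y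

/-- Edge-dominance: no proper subset of `E'` is a metapath from `B` to `C`. -/
def IsEdgeDominant (E : Set (MEdge α)) (B C : Set α) (E' : Set (MEdge α)) : Prop :=
  IsMetapath E B C E' ∧ ∀ F, F ⊂ E' → ¬ IsMetapath E B C F

/-- Input-dominance: there is no metapath from a proper subset of `B` to `C`. -/
def IsInputDominant (E : Set (MEdge α)) (B C : Set α) (E' : Set (MEdge α)) : Prop :=
  IsMetapath E B C E' ∧ ∀ B', B' ⊂ B → ∀ F, ¬ IsMetapath E B' C F

/-- Dominance: edge-dominant and input-dominant. -/
def IsDominant (E : Set (MEdge α)) (B C : Set α) (E' : Set (MEdge α)) : Prop :=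
  IsEdgeDominant E B C E' ∧ IsInputDominant E B C E'

/-- Edge-dominance with respect to the relaxed metapath definition. -/
def IsRelaxedEdgeDominant (E : Set (MEdge α)) (B C : Set α) (E' : Set (MEdge α)) : Prop :=
  IsRelaxedMetapath E B C E' ∧ ∀ F, F ⊂ E' → ¬ IsRelaxedMetapath E B C F

/-- Input-dominance with respect to the relaxed metapath definition. -/
def IsRelaxedInputDominant (E : Set (MEdge α)) (B C : Set α) (E' : Set (MEdge α)) : Prop :=
  IsRelaxedMetapath E B C E' ∧ ∀ B', B' ⊂ B → ∀ F, ¬ IsRelaxedMetapath E B' C F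

/-- Dominance with respect to the relaxed metapath definition. -/
def IsRelaxedDominant (E : Set (MEdge α)) (B C : Set α) (E' : Set (MEdge α)) : Prop :=
  IsRelaxedEdgeDominant E B C E' ∧ IsRelaxedInputDominant E B C E'

/-- Edge set of the Basu–Blanning projection of the metagraph with edge set `E`
over `X'`: for each invertex `V' ⊆ X'` of some dominant metapath `M(V',{x'})`
with `x' ∈ X'`, one edge `⟨V', W'⟩` where `W'` collects all such targets `x'`. -/
def BBP (E : Set (MEdge α)) (X' : Set α) : Set (MEdge α) :=
  { e | e.inv ⊆ X' ∧ (∃ x' ∈ X', ∃ M, IsDominant E e.inv {x'} M) ∧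
        e.out = { x' | x' ∈ X' ∧ ∃ M, IsDominant E e.inv {x'} M } }

/-- A metapath `M` with target `{x'}` is irreducible w.r.t. `X'` if no proper
subset of its edges forms a metapath `M(U,{x'})` with `U ⊆ X'`. -/
def Irreducible (E : Set (MEdge α)) (X' : Set α) (x' : α) (M : Set (MEdge α)) : Prop :=
  ¬ ∃ F, F ⊂ M ∧ ∃ U, U ⊆ X' ∧ IsMetapath E U {x'} F

/-- Edge set of the transitivity preserving projection of the metagraph with
edge set `E` over `X'`: as the Basu–Blanning projection, but collecting only
the irreducible dominant metapaths. -/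
def TPP (E : Set (MEdge α)) (X' : Set α) : Set (MEdge α) :=
  { e | e.inv ⊆ X' ∧
        (∃ x' ∈ X', ∃ M, IsDominant E e.inv {x'} M ∧ Irreducible E X' x' M) ∧
        e.out = { x' | x' ∈ X' ∧ ∃ M, IsDominant E e.inv {x'} M ∧ Irreducible E X' x' M } }

end MG

/-- Elements of the metagraphs `H_n`. -/
inductive Elt where
  | F0 : Elt
  | A : ℕ → Elt
  | B : ℕ → Elt
  | C : ℕ → Elt
  | D : ℕ → Elt
  | E : ℕ → Elt
deriving DecidableEq

/-- The generating set `X_n` of `H_n`. -/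
def Xn (n : ℕ) : Set Elt :=
  {Elt.F0} ∪ {x | ∃ i ≤ n, x = Elt.A i ∨ x = Elt.B i} ∪
    {x | ∃ i, 1 ≤ i ∧ i ≤ n ∧ (x = Elt.C i ∨ x = Elt.D i ∨ x = Elt.E i)}

/-- The edge set `E_n` of the metagraph `H_n`: the tail edge
`e_0 = ⟨{A_0,B_0},{F_0}⟩` together with, for each `1 ≤ i ≤ n`, the four edges
`e_{1,i} = ⟨{A_i},{C_i,D_i}⟩`, `e_{2,i} = ⟨{C_i},{A_{i-1}}⟩`,
`e_{3,i} = ⟨{B_i},{E_i}⟩`, `e_{4,i} = ⟨{D_i,E_i},{B_{i-1}}⟩`. -/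
def En (n : ℕ) : Set (MEdge Elt) :=
  {⟨{Elt.A 0, Elt.B 0}, {Elt.F0}⟩} ∪
  ⋃ i ∈ Set.Icc 1 n,
    ({⟨{Elt.A i}, {Elt.C i, Elt.D i}⟩,
      ⟨{Elt.C i}, {Elt.A (i - 1)}⟩,
      ⟨{Elt.B i}, {Elt.E i}⟩,
      ⟨{Elt.D i, Elt.E i}, {Elt.B (i - 1)}⟩} : Set (MEdge Elt))

/-- The projection set `X'_n = {A_i, B_i : 0 ≤ i ≤ n} ∪ {F_0}`. -/
def Xn' (n : ℕ) : Set Elt :=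
  {Elt.F0} ∪ {x | ∃ i ≤ n, x = Elt.A i ∨ x = Elt.B i}

namespace MG

variable {α : Type*} {E : Set (MEdge α)}

theorem IsSimplePath.singleton {e : MEdge α} {x y : α} (he : e ∈ E) (hx : x ∈ e.inv)
    (hy : y ∈ e.out) : IsSimplePath E [e] x y := by
  refine ⟨by simp, by simpa using he, fun _ => ⟨by simpa using hx, by simpa using hy⟩, ?_⟩
  exact List.isChain_singleton e

theorem IsSimplePath.cons {e : MEdge α} {p : List (MEdge α)} {x y z : α}
    (hp : IsSimplePath E p z y) (he : e ∈ E) (hx : x ∈ e.inv) (hz : z ∈ e.out) :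
    IsSimplePath E (e :: p) x y := by
  obtain ⟨hne, hmem, hends, hchain⟩ := hp
  cases p with
  | nil => exact absurd rfl hne
  | cons f p =>
    refine ⟨by simp, ?_, fun _ => ⟨by simpa using hx, by simpa using (hends hne).2⟩, ?_⟩
    · rintro g hg
      rcases List.mem_cons.1 hg with rfl | hg
      exacts [he, hmem g hg]
    · exact List.isChain_cons_cons.2 ⟨⟨z, hz, (hends hne).1⟩, hchain⟩

theorem IsSimplePath.of_forall_mem {E' : Set (MEdge α)} {p : List (MEdge α)} {x y : α}
    (hp : IsSimplePath E p x y) (h : ∀ e ∈ p, e ∈ E') : IsSimplePath E' p x y :=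
  ⟨hp.1, h, hp.2.2⟩

theorem IsSimplePath.exists_mem_out {p : List (MEdge α)} {x y : α} (hp : IsSimplePath E p x y) :
    ∃ e ∈ p, y ∈ e.out :=
  ⟨_, List.getLast_mem hp.1, (hp.2.2.1 hp.1).2⟩

/-- Two simple paths with a common end form a metapath from their starting points as soon as
every other input of their edges is an output of one of their edges. -/
theorem isMetapath_of_isSimplePath {p q : List (MEdge α)} {x y z : α}
    (hp : IsSimplePath E p x z) (hq : IsSimplePath E q y z)
    (hin : ∀ e, e ∈ p ∨ e ∈ q → ∀ v ∈ e.inv, v = x ∨ v = y ∨ ∃ f, (f ∈ p ∨ f ∈ q) ∧ v ∈ f.out) :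
    IsMetapath E {x, y} {z} {e | e ∈ p ∨ e ∈ q} := by
  refine ⟨⟨?_, ?_, ?_⟩, ?_⟩
  · rintro e (he | he)
    exacts [hp.2.1 e he, hq.2.1 e he]
  · rintro v ⟨hv, hv'⟩
    simp only [Set.mem_iUnion, Set.mem_ofPred_eq, exists_prop] at hv hv'
    obtain ⟨e, he, hve⟩ := hv
    rcases hin e he v hve with h | h | h
    · exact Or.inl h
    · exact Or.inr h
    · exact absurd h hv'
  · rintro _ rfl
    obtain ⟨e, he, hze⟩ := hp.exists_mem_out
    exact Set.mem_biUnion (Or.inl he) hze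
  · rintro e (he | he)
    · exact ⟨p, x, z, by simp, rfl, he, hp.of_forall_mem fun _ => Or.inl⟩
    · exact ⟨q, y, z, by simp, rfl, he, hq.of_forall_mem fun _ => Or.inr⟩

theorem IsRelaxedMetapath.exists_mem_out_of_mem_inv {B C M : Set _}
    (h : IsRelaxedMetapath E B C M) {e : MEdge α} (he : e ∈ M) {v : α} (hv : v ∈ e.inv) :
    v ∈ B ∨ ∃ f ∈ M, v ∈ f.out := by
  by_contra! hc
  refine hc.1 (h.2.1 ⟨Set.mem_biUnion he hv, ?_⟩)
  simpa using hc.2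

theorem IsRelaxedMetapath.exists_mem_out_of_mem_target {B C M : Set _}
    (h : IsRelaxedMetapath E B C M) {x : α} (hx : x ∈ C) : ∃ f ∈ M, x ∈ f.out := by
  simpa using h.2.2 hx

theorem IsMetapath.source_nonempty {B : Set α} {x : α} {M : Set (MEdge α)}
    (h : IsMetapath E B {x} M) : B.Nonempty := by
  obtain ⟨e, he, -⟩ := h.1.exists_mem_out_of_mem_target rfl
  obtain ⟨-, y, -, hy, -⟩ := h.2 e he
  exact ⟨y, hy⟩

/-- Within a finite metapath whose source cannot be shrunk there is a dominant one. -/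
theorem IsMetapath.exists_isDominant {B C : Set α} {M : Set (MEdge α)}
    (h : IsMetapath E B C M) (hE : E.Finite)
    (hB : ∀ B', B' ⊂ B → ∀ F, ¬ IsMetapath E B' C F) : ∃ M', IsDominant E B C M' := by
  have hfin : {F | IsMetapath E B C F}.Finite := hE.finite_subsets.subset fun F hF => hF.1.1
  obtain ⟨F, hF⟩ := hfin.exists_minimal ⟨M, h⟩
  exact ⟨F, ⟨hF.prop, fun G hG hG' => hG.2 (hF.le_of_le hG' hG.1)⟩, hF.prop, hB⟩

/-- The source of a dominant metapath has no proper subset that is a source. -/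
theorem IsDominant.source_eq {B B' C : Set α} {M F : Set (MEdge α)} (h : IsDominant E B C M)
    (hF : IsMetapath E B' C F) (hB : B' ⊆ B) : B = B' := by
  by_contra hne
  exact h.2.2 B' (hB.ssubset_of_ne (Ne.symm hne)) F hF

end MG

namespace HGraph

open MG

/-- The edge `e_0`. -/
def tail : MEdge Elt := ⟨{Elt.A 0, Elt.B 0}, {Elt.F0}⟩

/-- The edge `e_{1,i+1}`. -/
def splitA (i : ℕ) : MEdge Elt := ⟨{Elt.A (i + 1)}, {Elt.C (i + 1), Elt.D (i + 1)}⟩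

/-- The edge `e_{2,i+1}`. -/
def stepA (i : ℕ) : MEdge Elt := ⟨{Elt.C (i + 1)}, {Elt.A i}⟩

/-- The edge `e_{3,i+1}`. -/
def liftB (i : ℕ) : MEdge Elt := ⟨{Elt.B (i + 1)}, {Elt.E (i + 1)}⟩

/-- The edge `e_{4,i+1}`. -/
def stepB (i : ℕ) : MEdge Elt := ⟨{Elt.D (i + 1), Elt.E (i + 1)}, {Elt.B i}⟩

variable {n : ℕ}

theorem mem_En {e : MEdge Elt} : e ∈ En n ↔
    e = tail ∨ ∃ i < n, e = splitA i ∨ e = stepA i ∨ e = liftB i ∨ e = stepB i := by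
  simp only [En, Set.mem_union, Set.mem_singleton_iff, Set.mem_iUnion, Set.mem_Icc,
    Set.mem_insert_iff, exists_prop]
  refine or_congr Iff.rfl ⟨?_, ?_⟩
  · rintro ⟨i, ⟨h1, h2⟩, h⟩
    obtain ⟨k, rfl⟩ : ∃ k, i = k + 1 := ⟨i - 1, by omega⟩
    exact ⟨k, by omega, h⟩
  · rintro ⟨i, hi, h⟩
    exact ⟨i + 1, ⟨by omega, by omega⟩, h⟩

theorem En_finite (n : ℕ) : (En n).Finite :=
  (Set.finite_singleton _).union
    ((Set.finite_Icc 1 n).biUnion fun _ _ => by simp)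

theorem tail_mem_En : tail ∈ En n := mem_En.2 (Or.inl rfl)

theorem splitA_mem_En {i : ℕ} (h : i < n) : splitA i ∈ En n :=
  mem_En.2 (Or.inr ⟨i, h, Or.inl rfl⟩)

theorem stepA_mem_En {i : ℕ} (h : i < n) : stepA i ∈ En n :=
  mem_En.2 (Or.inr ⟨i, h, Or.inr (Or.inl rfl)⟩)

theorem liftB_mem_En {i : ℕ} (h : i < n) : liftB i ∈ En n :=
  mem_En.2 (Or.inr ⟨i, h, Or.inr (Or.inr (Or.inl rfl))⟩)

theorem stepB_mem_En {i : ℕ} (h : i < n) : stepB i ∈ En n :=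
  mem_En.2 (Or.inr ⟨i, h, Or.inr (Or.inr (Or.inr rfl))⟩)

section Producers

variable {e : MEdge Elt} {k : ℕ} (he : e ∈ En n)
include he

theorem eq_tail (h : Elt.F0 ∈ e.out) : e = tail := by
  rcases mem_En.1 he with rfl | ⟨i, hi, rfl | rfl | rfl | rfl⟩ <;>
    simp_all [tail, splitA, stepA, liftB, stepB]

theorem eq_stepA (h : Elt.A k ∈ e.out) : k < n ∧ e = stepA k := by
  rcases mem_En.1 he with rfl | ⟨i, hi, rfl | rfl | rfl | rfl⟩ <;>
    simp_all [tail, splitA, stepA, liftB, stepB]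

theorem eq_stepB (h : Elt.B k ∈ e.out) : k < n ∧ e = stepB k := by
  rcases mem_En.1 he with rfl | ⟨i, hi, rfl | rfl | rfl | rfl⟩ <;>
    simp_all [tail, splitA, stepA, liftB, stepB]

theorem eq_splitA_of_C (h : Elt.C (k + 1) ∈ e.out) : e = splitA k := by
  rcases mem_En.1 he with rfl | ⟨i, hi, rfl | rfl | rfl | rfl⟩ <;>
    simp_all [tail, splitA, stepA, liftB, stepB]

theorem eq_splitA_of_D (h : Elt.D (k + 1) ∈ e.out) : e = splitA k := by
  rcases mem_En.1 he with rfl | ⟨i, hi, rfl | rfl | rfl | rfl⟩ <;>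
    simp_all [tail, splitA, stepA, liftB, stepB]

theorem eq_liftB (h : Elt.E (k + 1) ∈ e.out) : e = liftB k := by
  rcases mem_En.1 he with rfl | ⟨i, hi, rfl | rfl | rfl | rfl⟩ <;>
    simp_all [tail, splitA, stepA, liftB, stepB]

end Producers

section Sources

variable {V T : Set Elt} {M : Set (MEdge Elt)} (hM : IsRelaxedMetapath (En n) V T M)
  (hV : V ⊆ Xn' n)
include hM hV

theorem splitA_mem_of_stepA_mem {k : ℕ} (h : stepA k ∈ M) : splitA k ∈ M := by
  rcases hM.exists_mem_out_of_mem_inv h (v := Elt.C (k + 1)) rfl with hc | ⟨f, hf, hfo⟩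
  · simpa [Xn'] using hV hc
  · exact eq_splitA_of_C (hM.1 hf) hfo ▸ hf

theorem splitA_mem_of_stepB_mem {k : ℕ} (h : stepB k ∈ M) : splitA k ∈ M := by
  rcases hM.exists_mem_out_of_mem_inv h (v := Elt.D (k + 1)) (by simp [stepB]) with
    hc | ⟨f, hf, hfo⟩
  · simpa [Xn'] using hV hc
  · exact eq_splitA_of_D (hM.1 hf) hfo ▸ hf

theorem liftB_mem_of_stepB_mem {k : ℕ} (h : stepB k ∈ M) : liftB k ∈ M := by
  rcases hM.exists_mem_out_of_mem_inv h (v := Elt.E (k + 1)) (by simp [stepB]) with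
    hc | ⟨f, hf, hfo⟩
  · simpa [Xn'] using hV hc
  · exact eq_liftB (hM.1 hf) hfo ▸ hf

theorem exists_A_mem_source {k : ℕ} {e : MEdge Elt} (he : e ∈ M) (hk : Elt.A k ∈ e.inv) :
    ∃ i, k ≤ i ∧ i ≤ n ∧ Elt.A i ∈ V := by
  induction hd : n - k generalizing k e with
  | zero =>
    rcases hM.exists_mem_out_of_mem_inv he hk with h | ⟨f, hf, hfo⟩
    · exact ⟨k, le_rfl, by simpa [Xn'] using hV h, h⟩
    · have := (eq_stepA (hM.1 hf) hfo).1
      omega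
  | succ d ih =>
    rcases hM.exists_mem_out_of_mem_inv he hk with h | ⟨f, hf, hfo⟩
    · exact ⟨k, le_rfl, by simpa [Xn'] using hV h, h⟩
    · obtain ⟨-, rfl⟩ := eq_stepA (hM.1 hf) hfo
      obtain ⟨i, hi, h⟩ := ih (splitA_mem_of_stepA_mem hM hV hf) (k := k + 1) rfl (by omega)
      exact ⟨i, by omega, h⟩

/-- If `B_k` and `A_k` are consumed, the source contains some `B_j` with `k ≤ j`, and `A_j` is
consumed. -/
theorem exists_B_mem_source {k : ℕ} {e f : MEdge Elt} (he : e ∈ M) (hk : Elt.B k ∈ e.inv)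
    (hf : f ∈ M) (hkf : Elt.A k ∈ f.inv) :
    ∃ j, k ≤ j ∧ Elt.B j ∈ V ∧ ∃ g ∈ M, Elt.A j ∈ g.inv := by
  induction hd : n - k generalizing k e f with
  | zero =>
    rcases hM.exists_mem_out_of_mem_inv he hk with h | ⟨g, hg, hgo⟩
    · exact ⟨k, le_rfl, h, f, hf, hkf⟩
    · have := (eq_stepB (hM.1 hg) hgo).1
      omega
  | succ d ih =>
    rcases hM.exists_mem_out_of_mem_inv he hk with h | ⟨g, hg, hgo⟩
    · exact ⟨k, le_rfl, h, f, hf, hkf⟩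
    · obtain ⟨-, rfl⟩ := eq_stepB (hM.1 hg) hgo
      obtain ⟨j, hj, h⟩ := ih (liftB_mem_of_stepB_mem hM hV hg) (k := k + 1) rfl
        (splitA_mem_of_stepB_mem hM hV hg) rfl (by omega)
      exact ⟨j, by omega, h⟩

theorem exists_pair_subset_source {k : ℕ} {e f : MEdge Elt} (he : e ∈ M) (hk : Elt.B k ∈ e.inv)
    (hf : f ∈ M) (hkf : Elt.A k ∈ f.inv) :
    ∃ i j, k ≤ j ∧ j ≤ i ∧ i ≤ n ∧ {Elt.A i, Elt.B j} ⊆ V := by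
  obtain ⟨j, hj, hjV, g, hg, hgA⟩ := exists_B_mem_source hM hV he hk hf hkf
  obtain ⟨i, hi, hin, hiV⟩ := exists_A_mem_source hM hV hg hgA
  exact ⟨i, j, hj, hi, hin, Set.pair_subset hiV hjV⟩

end Sources

/-- The path from `A_{k+m}` down to `A_k`, followed by `l`. -/
def aPath (l : List (MEdge Elt)) (k : ℕ) : ℕ → List (MEdge Elt)
  | 0 => l
  | m + 1 => splitA (k + m) :: stepA (k + m) :: aPath l k m

/-- The path from `B_{k+m}` down to `B_k`, followed by `l`. -/
def bPath (l : List (MEdge Elt)) (k : ℕ) : ℕ → List (MEdge Elt)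
  | 0 => l
  | m + 1 => liftB (k + m) :: stepB (k + m) :: bPath l k m

theorem mem_aPath {l : List (MEdge Elt)} {k m : ℕ} {e : MEdge Elt} :
    e ∈ aPath l k m ↔ e ∈ l ∨ ∃ t < m, e = splitA (k + t) ∨ e = stepA (k + t) := by
  induction m with
  | zero => simp [aPath]
  | succ m ih =>
    simp only [aPath, List.mem_cons, ih, Nat.lt_succ_iff_lt_or_eq, or_and_right, exists_or,
      exists_eq_left]
    grind

theorem mem_bPath {l : List (MEdge Elt)} {k m : ℕ} {e : MEdge Elt} :
    e ∈ bPath l k m ↔ e ∈ l ∨ ∃ t < m, e = liftB (k + t) ∨ e = stepB (k + t) := by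
  induction m with
  | zero => simp [bPath]
  | succ m ih =>
    simp only [bPath, List.mem_cons, ih, Nat.lt_succ_iff_lt_or_eq, or_and_right, exists_or,
      exists_eq_left]
    grind

theorem isSimplePath_aPath {l : List (MEdge Elt)} {k m : ℕ} {y : Elt}
    (hl : IsSimplePath (En n) l (Elt.A k) y) (hn : k + m ≤ n) :
    IsSimplePath (En n) (aPath l k m) (Elt.A (k + m)) y := by
  induction m with
  | zero => exact hl
  | succ m ih =>
    exact ((ih (by omega)).cons (stepA_mem_En (by omega)) (x := Elt.C (k + m + 1)) rfl rfl).cons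
      (splitA_mem_En (by omega)) rfl (by simp [splitA])

theorem isSimplePath_bPath {l : List (MEdge Elt)} {k m : ℕ} {y : Elt}
    (hl : IsSimplePath (En n) l (Elt.B k) y) (hn : k + m ≤ n) :
    IsSimplePath (En n) (bPath l k m) (Elt.B (k + m)) y := by
  induction m with
  | zero => exact hl
  | succ m ih =>
    exact ((ih (by omega)).cons (stepB_mem_En (by omega)) (x := Elt.E (k + m + 1))
      (by simp [stepB]) rfl).cons (liftB_mem_En (by omega)) rfl rfl

theorem exists_isMetapath_A {i k : ℕ} (hki : k < i) (hi : i ≤ n) :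
    ∃ M, IsMetapath (En n) {Elt.A i} {Elt.A k} M := by
  obtain ⟨m, rfl⟩ := Nat.exists_eq_add_of_le (Nat.succ_le_of_lt hki)
  have hl : IsSimplePath (En n) [splitA k, stepA k] (Elt.A (k + 1)) (Elt.A k) :=
    (IsSimplePath.singleton (stepA_mem_En (by omega)) (x := Elt.C (k + 1)) rfl rfl).cons
      (splitA_mem_En (by omega)) rfl (by simp [splitA])
  have hp := isSimplePath_aPath hl hi
  have h := isMetapath_of_isSimplePath hp hp ?_
  · exact ⟨_, by simpa only [Set.pair_eq_singleton] using h⟩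
  simp only [or_self, mem_aPath]
  have hA : ∀ t ≤ m, Elt.A (k + 1 + t) = Elt.A (k + 1 + m) ∨
      ∃ f, (f ∈ [splitA k, stepA k] ∨
        ∃ t < m, f = splitA (k + 1 + t) ∨ f = stepA (k + 1 + t)) ∧ Elt.A (k + 1 + t) ∈ f.out := by
    intro t ht
    rcases ht.eq_or_lt with rfl | ht
    · exact Or.inl rfl
    · exact Or.inr ⟨_, Or.inr ⟨t, ht, Or.inr rfl⟩, rfl⟩
  rintro e (he | ⟨t, ht, rfl | rfl⟩) v hv
  · rcases List.mem_pair.1 he with rfl | rfl <;> obtain rfl := hv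
    · exact Or.inr (hA 0 (Nat.zero_le m))
    · exact Or.inr (Or.inr ⟨splitA k, by simp, by simp [splitA]⟩)
  · obtain rfl := hv
    exact Or.inr (hA (t + 1) ht)
  · obtain rfl := hv
    exact Or.inr (Or.inr ⟨_, Or.inr ⟨t, ht, Or.inl rfl⟩, by simp [splitA]⟩)

/-- The `A`-path from `A_{k+a}` and the `B`-path from `B_{k+b}` with `b ≤ a` form a metapath,
provided all inputs of their final segments other than `A_k` and `B_k` are produced by
these segments. -/
theorem isMetapath_pair {l l' : List (MEdge Elt)} {k a b : ℕ} {y : Elt} (hba : b ≤ a)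
    (ha : k + a ≤ n)
    (hl : IsSimplePath (En n) l (Elt.A k) y) (hl' : IsSimplePath (En n) l' (Elt.B k) y)
    (hin : ∀ e, e ∈ l ∨ e ∈ l' → ∀ v ∈ e.inv,
      v = Elt.A k ∨ v = Elt.B k ∨ ∃ f, (f ∈ l ∨ f ∈ l') ∧ v ∈ f.out) :
    ∃ M, IsMetapath (En n) {Elt.A (k + a), Elt.B (k + b)} {y} M := by
  refine ⟨_, isMetapath_of_isSimplePath (isSimplePath_aPath hl ha)
    (isSimplePath_bPath hl' (by omega)) ?_⟩
  simp only [mem_aPath, mem_bPath]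
  have hA : ∀ t ≤ a, t = a ∨ ∃ f, ((f ∈ l ∨ ∃ t < a, f = splitA (k + t) ∨ f = stepA (k + t)) ∨
      (f ∈ l' ∨ ∃ t < b, f = liftB (k + t) ∨ f = stepB (k + t))) ∧ Elt.A (k + t) ∈ f.out := by
    intro t ht
    rcases ht.eq_or_lt with rfl | ht
    · exact Or.inl rfl
    · exact Or.inr ⟨_, Or.inl (Or.inr ⟨t, ht, Or.inr rfl⟩), rfl⟩
  have hB : ∀ t ≤ b, t = b ∨ ∃ f, ((f ∈ l ∨ ∃ t < a, f = splitA (k + t) ∨ f = stepA (k + t)) ∨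
      (f ∈ l' ∨ ∃ t < b, f = liftB (k + t) ∨ f = stepB (k + t))) ∧ Elt.B (k + t) ∈ f.out := by
    intro t ht
    rcases ht.eq_or_lt with rfl | ht
    · exact Or.inl rfl
    · exact Or.inr ⟨_, Or.inr (Or.inr ⟨t, ht, Or.inr rfl⟩), rfl⟩
  have hends : ∀ e, e ∈ l ∨ e ∈ l' → ∀ v ∈ e.inv, v = Elt.A (k + a) ∨ v = Elt.B (k + b) ∨
      ∃ f, ((f ∈ l ∨ ∃ t < a, f = splitA (k + t) ∨ f = stepA (k + t)) ∨
        (f ∈ l' ∨ ∃ t < b, f = liftB (k + t) ∨ f = stepB (k + t))) ∧ v ∈ f.out := by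
    intro e he v hv
    rcases hin e he v hv with rfl | rfl | ⟨f, hf, hvf⟩
    · exact (hA 0 (Nat.zero_le a)).imp (fun h => by rw [← h]; rfl) Or.inr
    · exact Or.inr ((hB 0 (Nat.zero_le b)).imp_left fun h => by rw [← h]; rfl)
    · exact Or.inr (Or.inr ⟨f, hf.imp Or.inl Or.inl, hvf⟩)
  rintro e ((he | ⟨t, ht, rfl | rfl⟩) | (he | ⟨t, ht, rfl | rfl⟩)) v hv
  · exact hends e (Or.inl he) v hv
  · obtain rfl := hv
    exact (hA (t + 1) ht).imp (fun h => by rw [← h]; rfl) Or.inr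
  · obtain rfl := hv
    exact Or.inr (Or.inr ⟨_, Or.inl (Or.inr ⟨t, ht, Or.inl rfl⟩), by simp [splitA]⟩)
  · exact hends e (Or.inr he) v hv
  · obtain rfl := hv
    exact Or.inr ((hB (t + 1) ht).imp_left fun h => by rw [← h]; rfl)
  · rcases hv with rfl | rfl
    · exact Or.inr (Or.inr ⟨_, Or.inl (Or.inr ⟨t, ht.trans_le hba, Or.inl rfl⟩),
        by simp [splitA]⟩)
    · exact Or.inr (Or.inr ⟨_, Or.inr (Or.inr ⟨t, ht, Or.inl rfl⟩), rfl⟩)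

theorem exists_isMetapath_F0 {i j : ℕ} (hji : j ≤ i) (hi : i ≤ n) :
    ∃ M, IsMetapath (En n) {Elt.A i, Elt.B j} {Elt.F0} M := by
  have h := isMetapath_pair (n := n) (k := 0) (l := [tail]) (l' := [tail]) (y := Elt.F0) hji
    (by omega) (IsSimplePath.singleton tail_mem_En (by simp [tail]) rfl)
    (IsSimplePath.singleton tail_mem_En (by simp [tail]) rfl) (by simp [tail])
  simpa using h

theorem exists_isMetapath_B {i j k : ℕ} (hkj : k < j) (hji : j ≤ i) (hi : i ≤ n) :
    ∃ M, IsMetapath (En n) {Elt.A i, Elt.B j} {Elt.B k} M := by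
  obtain ⟨b, rfl⟩ := Nat.exists_eq_add_of_le (Nat.succ_le_of_lt hkj)
  obtain ⟨a, rfl⟩ := Nat.exists_eq_add_of_le (hkj.trans_le hji)
  have hs : stepB k ∈ En n := stepB_mem_En (by omega)
  refine isMetapath_pair (l := [splitA k, stepB k]) (l' := [liftB k, stepB k]) (by omega) hi
    ((IsSimplePath.singleton hs (x := Elt.D (k + 1)) (by simp [stepB]) rfl).cons
      (splitA_mem_En (by omega)) rfl (by simp [splitA]))
    ((IsSimplePath.singleton hs (x := Elt.E (k + 1)) (by simp [stepB]) rfl).cons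
      (liftB_mem_En (by omega)) rfl rfl) ?_
  have hfinal : ∀ e ∈ [splitA k, liftB k, stepB k], ∀ v ∈ e.inv, v = Elt.A (k + 1) ∨
      v = Elt.B (k + 1) ∨ ∃ f ∈ [splitA k, liftB k, stepB k], v ∈ f.out := by
    simp [splitA, stepB, liftB]
  have hmem : ∀ e, (e ∈ [splitA k, stepB k] ∨ e ∈ [liftB k, stepB k]) ↔
      e ∈ [splitA k, liftB k, stepB k] := by
    simp only [List.mem_cons, List.not_mem_nil, or_false]
    grind
  simpa only [hmem] using hfinal

theorem not_isMetapath_F0_of_ssubset {i j : ℕ} {V : Set Elt} (hV : V ⊆ Xn' n)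
    (h : V ⊂ {Elt.A i, Elt.B j}) (F : Set (MEdge Elt)) :
    ¬ IsMetapath (En n) V {Elt.F0} F := by
  intro hF
  obtain ⟨e, he, heo⟩ := hF.1.exists_mem_out_of_mem_target rfl
  obtain rfl := eq_tail (hF.1.1 he) heo
  obtain ⟨i', j', -, -, -, hsub⟩ := exists_pair_subset_source hF.1 hV he (k := 0)
    (by simp [tail]) he (by simp [tail])
  have hA := h.1 (hsub (Set.mem_insert _ _))
  have hB := h.1 (hsub (Set.mem_insert_of_mem _ rfl))
  simp only [Set.mem_insert_iff, Set.mem_singleton_iff, Elt.A.injEq, Elt.B.injEq, reduceCtorEq,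
    or_false, false_or] at hA hB
  exact h.2 (hA ▸ hB ▸ hsub)

theorem setOf_source_eq (n : ℕ) :
    {V : Set Elt | V ⊆ Xn' n ∧ ∃ x' ∈ Xn' n, ∃ M, IsDominant (En n) V {x'} M} =
      {V : Set Elt | ∃ i j, j ≤ i ∧ i ≤ n ∧ V = {Elt.A i, Elt.B j}} ∪
       {V : Set Elt | ∃ i, 1 ≤ i ∧ i ≤ n ∧ V = {Elt.A i}} := by
  ext V
  constructor
  · rintro ⟨hV, x, hx, M, hM⟩
    have hrel := hM.1.1.1
    obtain ⟨e, he, heo⟩ := hrel.exists_mem_out_of_mem_target rfl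
    rcases hx with rfl | ⟨k, -, rfl | rfl⟩
    · obtain rfl := eq_tail (hrel.1 he) heo
      obtain ⟨i, j, -, hji, hi, hsub⟩ := exists_pair_subset_source hrel hV he (k := 0)
        (by simp [tail]) he (by simp [tail])
      obtain ⟨F, hF⟩ := exists_isMetapath_F0 hji hi
      exact Or.inl ⟨i, j, hji, hi, hM.source_eq hF hsub⟩
    · obtain ⟨-, rfl⟩ := eq_stepA (hrel.1 he) heo
      obtain ⟨i, hki, hi, hiV⟩ := exists_A_mem_source hrel hV
        (splitA_mem_of_stepA_mem hrel hV he) (k := k + 1) rfl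
      obtain ⟨F, hF⟩ := exists_isMetapath_A hki hi
      exact Or.inr ⟨i, by omega, hi, hM.source_eq hF (Set.singleton_subset_iff.2 hiV)⟩
    · obtain ⟨-, rfl⟩ := eq_stepB (hrel.1 he) heo
      obtain ⟨i, j, hkj, hji, hi, hsub⟩ := exists_pair_subset_source hrel hV
        (liftB_mem_of_stepB_mem hrel hV he) (k := k + 1) rfl
        (splitA_mem_of_stepB_mem hrel hV he) rfl
      obtain ⟨F, hF⟩ := exists_isMetapath_B hkj hji hi
      exact Or.inl ⟨i, j, hji, hi, hM.source_eq hF hsub⟩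
  · rintro (⟨i, j, hji, hi, rfl⟩ | ⟨i, h1, hi, rfl⟩)
    · have hV : ({Elt.A i, Elt.B j} : Set Elt) ⊆ Xn' n :=
        Set.pair_subset (by simpa [Xn'] using hi) (by simpa [Xn'] using hji.trans hi)
      obtain ⟨F, hF⟩ := exists_isMetapath_F0 hji hi
      exact ⟨hV, Elt.F0, by simp [Xn'], hF.exists_isDominant (En_finite n) fun B' hB' =>
        not_isMetapath_F0_of_ssubset (hB'.1.trans hV) hB'⟩
    · obtain ⟨F, hF⟩ := exists_isMetapath_A (k := i - 1) (by omega) hi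
      refine ⟨by simpa [Xn'] using hi, Elt.A (i - 1), by simp [Xn']; omega,
        hF.exists_isDominant (En_finite n) fun B' hB' G hG => ?_⟩
      exact hG.source_nonempty.ne_empty (Set.ssubset_singleton_iff.1 hB')

theorem ncard_pairs (n : ℕ) :
    {V : Set Elt | ∃ i j, j ≤ i ∧ i ≤ n ∧ V = {Elt.A i, Elt.B j}}.ncard =
      (n + 1) * (n + 2) / 2 := by
  have himage : {V : Set Elt | ∃ i j, j ≤ i ∧ i ≤ n ∧ V = {Elt.A i, Elt.B j}} =
      (fun p : (_ : ℕ) × ℕ => ({Elt.A p.1, Elt.B p.2} : Set Elt)) ''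
        ((Finset.range (n + 1)).sigma fun i => Finset.range (i + 1) : Finset _) := by
    ext V
    simp only [Set.mem_ofPred_eq, Set.mem_image, Finset.mem_coe, Finset.mem_sigma,
      Finset.mem_range, Nat.lt_succ_iff, Sigma.exists]
    exact ⟨fun ⟨i, j, h1, h2, h⟩ => ⟨i, j, ⟨h2, h1⟩, h.symm⟩,
      fun ⟨i, j, ⟨h2, h1⟩, h⟩ => ⟨i, j, h1, h2, h.symm⟩⟩
  have hinj : Function.Injective
      fun p : (_ : ℕ) × ℕ => ({Elt.A p.1, Elt.B p.2} : Set Elt) := by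
    rintro ⟨i, j⟩ ⟨i', j'⟩ h
    have hA := h.subset (Set.mem_insert _ _)
    have hB := h.subset (Set.mem_insert_of_mem _ rfl)
    simp_all
  rw [himage, Set.ncard_image_of_injective _ hinj, Set.ncard_coe_finset, Finset.card_sigma]
  simp only [Finset.card_range]
  have hsum := Finset.sum_range_succ' (fun i => i) (n + 1)
  rw [Finset.sum_range_id] at hsum
  simpa [mul_comm] using hsum.symm

theorem ncard_singletons (n : ℕ) :
    {V : Set Elt | ∃ i, 1 ≤ i ∧ i ≤ n ∧ V = {Elt.A i}}.ncard = n := by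
  have himage : {V : Set Elt | ∃ i, 1 ≤ i ∧ i ≤ n ∧ V = {Elt.A i}} =
      (fun i => ({Elt.A i} : Set Elt)) '' (Finset.Icc 1 n : Finset ℕ) := by
    ext V
    simp only [Set.mem_ofPred_eq, Set.mem_image, Finset.mem_coe, Finset.mem_Icc, and_assoc,
      eq_comm]
  have hinj : Function.Injective fun i => ({Elt.A i} : Set Elt) := fun i j h => by
    simpa using h
  rw [himage, Set.ncard_image_of_injective _ hinj, Set.ncard_coe_finset, Nat.card_Icc]
  omega

end HGraph

/-- For every `n ≥ 1`, the invertices of dominant metapaths `M(V,{x'})` in `H_n`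
with `V ⊆ X'_n` and target `x' ∈ X'_n` are exactly the pairs `{A_i, B_j}` with
`0 ≤ j ≤ i ≤ n` together with the singletons `{A_i}` with `1 ≤ i ≤ n`, and
there are `(n+1)(n+2)/2 + n = (n² + 5n + 2)/2` such distinct invertices. -/
theorem stmt_1 (n : ℕ) (hn : 1 ≤ n) :
    ({V : Set Elt | V ⊆ Xn' n ∧ ∃ x' ∈ Xn' n, ∃ M, MG.IsDominant (En n) V {x'} M} =
      ({V : Set Elt | ∃ i j, j ≤ i ∧ i ≤ n ∧ V = {Elt.A i, Elt.B j}} ∪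
       {V : Set Elt | ∃ i, 1 ≤ i ∧ i ≤ n ∧ V = {Elt.A i}})) ∧
    {V : Set Elt | V ⊆ Xn' n ∧ ∃ x' ∈ Xn' n, ∃ M, MG.IsDominant (En n) V {x'} M}.ncard =
      (n + 1) * (n + 2) / 2 + n ∧
    (n + 1) * (n + 2) / 2 + n = (n ^ 2 + 5 * n + 2) / 2 := by
  have hpairs : {V : Set Elt | ∃ i j, j ≤ i ∧ i ≤ n ∧ V = {Elt.A i, Elt.B j}}.Finite := by
    refine Set.finite_of_ncard_ne_zero ?_
    rw [HGraph.ncard_pairs]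
    have : 2 ≤ (n + 1) * (n + 2) := by nlinarith
    omega
  have hsingletons : {V : Set Elt | ∃ i, 1 ≤ i ∧ i ≤ n ∧ V = {Elt.A i}}.Finite :=
    Set.finite_of_ncard_ne_zero (by rw [HGraph.ncard_singletons]; omega)
  have hdisj : Disjoint {V : Set Elt | ∃ i j, j ≤ i ∧ i ≤ n ∧ V = {Elt.A i, Elt.B j}}
      {V : Set Elt | ∃ i, 1 ≤ i ∧ i ≤ n ∧ V = {Elt.A i}} := by
    rw [Set.disjoint_left]
    rintro _ ⟨i, j, -, -, rfl⟩ ⟨i', -, -, h⟩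
    simpa using h.subset (Set.mem_insert_of_mem _ rfl)
  refine ⟨HGraph.setOf_source_eq n, ?_, ?_⟩
  · rw [HGraph.setOf_source_eq, Set.ncard_union_eq hdisj hpairs hsingletons,
      HGraph.ncard_pairs, HGraph.ncard_singletons]
  · rw [← Nat.add_mul_div_right _ _ two_pos]
    ring_nf
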